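/- arXiv:1111.4937 — 3 statements merged into one kernel-verified Lean document; each statement's English description precedes it below -/
import Mathlib

section
/- If R is a staircase with at least two blocks and r is a deletable rectangle of R, then R ∖ {r} is a staircase. -/
open Set

/-- A block is a closed axis-parallel rectangle `[x1,x2] × [y1,y2]` with `x1 < x2`, `y1 < y2`. -/
def IsBlock (b : Set (ℝ × ℝ)) : Prop :=
  ∃ x1 x2 y1 y2 : ℝ, x1 < x2 ∧ y1 < y2 ∧ b = Icc x1 x2 ×ˢ Icc y1 y2

/-- `R` is a staircase with `m` steps, step x-coordinates `a 0 < a 1 < ⋯ < a m`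
(with `a 0 = 0`) and step heights `h 1 > h 2 > ⋯ > h m > 0`. -/
def IsStaircaseWith (R : Finset (Set (ℝ × ℝ))) (m : ℕ) (a h : ℕ → ℝ) : Prop :=
  R.Nonempty ∧
  (∀ b ∈ R, IsBlock b) ∧
  (∀ b ∈ R, ∀ b' ∈ R, b ≠ b' → interior b ∩ interior b' = ∅) ∧
  (∀ (p : ℝ × ℝ) (b1 b2 b3 b4 : Set (ℝ × ℝ)),
      b1 ∈ R → b2 ∈ R → b3 ∈ R → b4 ∈ R →
      p ∈ b1 → p ∈ b2 → p ∈ b3 → p ∈ b4 →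
      b1 = b2 ∨ b1 = b3 ∨ b1 = b4 ∨ b2 = b3 ∨ b2 = b4 ∨ b3 = b4) ∧
  1 ≤ m ∧
  a 0 = 0 ∧
  (∀ j, j < m → a j < a (j + 1)) ∧
  (∀ j, 1 ≤ j → j < m → h (j + 1) < h j) ∧
  0 < h m ∧
  ⋃₀ (R : Set (Set (ℝ × ℝ))) =
    ⋃ j ∈ Finset.Icc 1 m, Icc (a (j - 1)) (a j) ×ˢ Icc (0 : ℝ) (h j)

/-- `R` is a staircase. -/
def IsStaircase (R : Finset (Set (ℝ × ℝ))) : Prop :=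
  ∃ m a h, IsStaircaseWith R m a h

/-- `r` is a deletable rectangle of `R`: a block of `R` whose top edge and right
edge are both contained in the topological boundary of `⋃ R`. -/
def IsDeletable (R : Finset (Set (ℝ × ℝ))) (r : Set (ℝ × ℝ)) : Prop :=
  r ∈ R ∧ ∃ x1 x2 y1 y2 : ℝ, x1 < x2 ∧ y1 < y2 ∧ r = Icc x1 x2 ×ˢ Icc y1 y2 ∧
    (Icc x1 x2 ×ˢ ({y2} : Set ℝ)) ⊆ frontier (⋃₀ (R : Set (Set (ℝ × ℝ)))) ∧
    (({x2} : Set ℝ) ×ˢ Icc y1 y2) ⊆ frontier (⋃₀ (R : Set (Set (ℝ × ℝ))))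

/-- A mosaic floorplan is a staircase with exactly one step. -/
def IsMosaicFloorplan (M : Finset (Set (ℝ × ℝ))) : Prop :=
  ∃ a h, IsStaircaseWith M 1 a h

noncomputable instance : DecidableEq (Set (ℝ × ℝ)) := Classical.decEq _

/-- The numbers `a 0, …, a m` and `h 1, …, h m` describe the steps of a staircase. -/
structure IsStepData (m : ℕ) (a h : ℕ → ℝ) : Prop where
  zero : a 0 = 0
  lt_succ : ∀ j, j < m → a j < a (j + 1)
  succ_lt : ∀ j, 1 ≤ j → j < m → h (j + 1) < h j
  pos : ∀ j, 1 ≤ j → j ≤ m → 0 < h j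

/-- The union of the boxes `[0, c.1] × [0, c.2]` over the corners `c ∈ C`. -/
def cornerRegion (C : Finset (ℝ × ℝ)) : Set (ℝ × ℝ) :=
  ⋃ c ∈ C, Icc 0 c.1 ×ˢ Icc 0 c.2

lemma mem_cornerRegion {C : Finset (ℝ × ℝ)} {p : ℝ × ℝ} :
    p ∈ cornerRegion C ↔ ∃ c ∈ C, (0 ≤ p.1 ∧ p.1 ≤ c.1) ∧ 0 ≤ p.2 ∧ p.2 ≤ c.2 := by
  simp only [cornerRegion, mem_iUnion, mem_prod, mem_Icc, exists_prop]

lemma isClosed_cornerRegion (C : Finset (ℝ × ℝ)) : IsClosed (cornerRegion C) :=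
  C.finite_toSet.isClosed_biUnion fun _ _ => isClosed_Icc.prod isClosed_Icc

lemma mem_interior_cornerRegion {C : Finset (ℝ × ℝ)} {c p : ℝ × ℝ} (hc : c ∈ C)
    (h1 : 0 < p.1) (h1' : p.1 < c.1) (h2 : 0 < p.2) (h2' : p.2 < c.2) :
    p ∈ interior (cornerRegion C) := by
  refine mem_interior.2 ⟨Ioo 0 c.1 ×ˢ Ioo 0 c.2, fun q hq => ?_, isOpen_Ioo.prod isOpen_Ioo,
    ⟨⟨h1, h1'⟩, h2, h2'⟩⟩
  exact mem_cornerRegion.2 ⟨c, hc, ⟨hq.1.1.le, hq.1.2.le⟩, hq.2.1.le, hq.2.2.le⟩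

namespace IsStepData

variable {m : ℕ} {a h : ℕ → ℝ}

lemma mono (H : IsStepData m a h) {i j : ℕ} (hij : i ≤ j) (hj : j ≤ m) : a i ≤ a j := by
  induction j, hij using Nat.le_induction with
  | base => exact le_rfl
  | succ n _ ih => exact (ih (by omega)).trans (H.lt_succ n (by omega)).le

lemma anti (H : IsStepData m a h) {i j : ℕ} (hi : 1 ≤ i) (hij : i ≤ j) (hj : j ≤ m) :
    h j ≤ h i := by
  induction j, hij using Nat.le_induction with
  | base => exact le_rfl
  | succ n hn ih => exact (H.succ_lt n (by omega) (by omega)).le.trans (ih (by omega))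

lemma left_pos (H : IsStepData m a h) {j : ℕ} (hj : 1 ≤ j) (hjm : j ≤ m) : 0 < a j := by
  have h0 := H.lt_succ 0 (by omega)
  rw [H.zero] at h0
  exact h0.trans_le (H.mono hj hjm)

lemma iUnion_strips (H : IsStepData m a h) :
    ⋃ j ∈ Finset.Icc 1 m, Icc (a (j - 1)) (a j) ×ˢ Icc (0 : ℝ) (h j) =
      cornerRegion ((Finset.Icc 1 m).image fun j => (a j, h j)) := by
  ext p
  simp only [mem_cornerRegion, mem_iUnion, mem_prod, mem_Icc, Finset.mem_Icc, Finset.mem_image,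
    exists_prop, exists_exists_and_eq_and]
  constructor
  · rintro ⟨j, ⟨hj, hjm⟩, ⟨h1, h2⟩, h3⟩
    refine ⟨j, ⟨hj, hjm⟩, ⟨?_, h2⟩, h3⟩
    exact H.zero.symm.le.trans ((H.mono (Nat.zero_le _) (by omega)).trans h1)
  · rintro ⟨j, ⟨hj, hjm⟩, ⟨h1, h2⟩, h3, h4⟩
    classical
    have hex : ∃ i, 1 ≤ i ∧ p.1 ≤ a i := ⟨j, hj, h2⟩
    obtain ⟨hi, hpi⟩ := Nat.find_spec hex
    have hij : Nat.find hex ≤ j := Nat.find_min' hex ⟨hj, h2⟩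
    refine ⟨Nat.find hex, ⟨hi, hij.trans hjm⟩, ⟨?_, hpi⟩, h3, h4.trans (H.anti hi hij hjm)⟩
    by_cases h1i : Nat.find hex = 1
    · simpa [h1i, H.zero] using h1
    · have hmin := Nat.find_min hex (m := Nat.find hex - 1) (by omega)
      by_contra hlt
      exact hmin ⟨by omega, (not_le.1 hlt).le⟩

end IsStepData

/-- Every finite set of positive corners spans a staircase-shaped region, whose width is at most
any bound on the first coordinates of the corners. -/
lemma exists_isStepData (C : Finset (ℝ × ℝ)) (hC : ∀ c ∈ C, 0 < c.1 ∧ 0 < c.2) :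
    ∃ m a h, IsStepData m a h ∧ (∀ M, 0 ≤ M → (∀ c ∈ C, c.1 ≤ M) → a m ≤ M) ∧
      cornerRegion C = cornerRegion ((Finset.Icc 1 m).image fun j => (a j, h j)) := by
  classical
  induction C using Finset.induction_on_max_value (fun c : ℝ × ℝ => c.1) with
  | empty => exact ⟨0, 0, 0, ⟨rfl, by simp, by simp, by intros; omega⟩, by simp, by simp⟩
  | insert c s _ hmax ih =>
    obtain ⟨m, a, h, H, hM, hreg⟩ := ih fun d hd => hC d (Finset.mem_insert_of_mem hd)
    obtain ⟨hx, hy⟩ := hC c (Finset.mem_insert_self _ _)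
    have ham : a m ≤ c.1 := hM _ hx.le hmax
    have hmem (p : ℝ × ℝ) : p ∈ cornerRegion (insert c s) ↔
        ((0 ≤ p.1 ∧ p.1 ≤ c.1) ∧ 0 ≤ p.2 ∧ p.2 ≤ c.2) ∨
          ∃ j, (1 ≤ j ∧ j ≤ m) ∧ (0 ≤ p.1 ∧ p.1 ≤ a j) ∧ 0 ≤ p.2 ∧ p.2 ≤ h j := by
      have := Set.ext_iff.1 hreg p
      simp only [mem_cornerRegion, Finset.mem_image, Finset.mem_Icc,
        exists_exists_and_eq_and] at this
      simp only [mem_cornerRegion, Finset.exists_mem_insert, this]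
    by_cases hdom : ∃ j, (1 ≤ j ∧ j ≤ m) ∧ c.1 ≤ a j ∧ c.2 ≤ h j
    · obtain ⟨j, hj, h1, h2⟩ := hdom
      refine ⟨m, a, h, H, fun M hM0 hb => hM M hM0 fun d hd =>
        hb d (Finset.mem_insert_of_mem hd), ?_⟩
      ext p
      rw [hmem]
      simp only [mem_cornerRegion, Finset.mem_image, Finset.mem_Icc, exists_exists_and_eq_and]
      refine ⟨?_, Or.inr⟩
      rintro (⟨⟨p1, p2⟩, p3, p4⟩ | hp)
      · exact ⟨j, hj, ⟨p1, p2.trans h1⟩, p3, p4.trans h2⟩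
      · exact hp
    · let P : ℕ → Prop := fun k => k = 0 ∨ c.2 < h k
      obtain ⟨k, hkm, hk, hgt⟩ : ∃ k, k ≤ m ∧ P k ∧ ∀ j, k < j → j ≤ m → h j ≤ c.2 := by
        refine ⟨Nat.findGreatest P m, Nat.findGreatest_le m,
          Nat.findGreatest_spec (P := P) (Nat.zero_le m) (Or.inl rfl), fun j hj hjm => ?_⟩
        have := Nat.findGreatest_is_greatest hj hjm
        exact not_lt.1 fun hlt => this (Or.inr hlt)
      have hak : a k < c.1 := by
        rcases Nat.eq_zero_or_pos k with rfl | hk0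
        · rwa [H.zero]
        · have hlt : c.2 < h k := hk.resolve_left (by omega)
          exact not_le.1 fun hle => hdom ⟨k, ⟨hk0, hkm⟩, hle, hlt.le⟩
      refine ⟨k + 1, fun j => if j ≤ k then a j else c.1, fun j => if j ≤ k then h j else c.2,
        ⟨by simp [H.zero], fun j hj => ?_, fun j h1 hj => ?_, fun j h1 hj => ?_⟩,
        fun M _ hb => by simpa using hb c (Finset.mem_insert_self _ _), ?_⟩
      · rcases Nat.lt_or_ge j k with hjk | hjk
        · simpa [hjk.le, Nat.succ_le_of_lt hjk] using H.lt_succ j (by omega)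
        · obtain rfl : j = k := by omega
          simpa using hak
      · rcases Nat.lt_or_ge j k with hjk | hjk
        · simpa [hjk.le, Nat.succ_le_of_lt hjk] using H.succ_lt j h1 (by omega)
        · obtain rfl : j = k := by omega
          simpa using hk.resolve_left (by omega)
      · split_ifs with hjk
        · exact H.pos j h1 (by omega)
        · exact hy
      · ext p
        rw [hmem]
        simp only [mem_cornerRegion, Finset.mem_image, Finset.mem_Icc, exists_exists_and_eq_and]
        constructor
        · rintro (hp | ⟨j, ⟨hj, hjm⟩, ⟨p1, p2⟩, p3, p4⟩)
          · exact ⟨k + 1, by omega, by simpa using hp⟩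
          · rcases Nat.lt_or_ge k j with hjk | hjk
            · refine ⟨k + 1, by omega, ?_⟩
              simpa using ⟨⟨p1, p2.trans ((H.mono hjm le_rfl).trans ham)⟩, p3,
                p4.trans (hgt j hjk hjm)⟩
            · exact ⟨j, by omega, by simpa [hjk] using ⟨⟨p1, p2⟩, p3, p4⟩⟩
        · rintro ⟨j, ⟨hj, hjm⟩, hp⟩
          by_cases hjk : j ≤ k
          · exact Or.inr ⟨j, by omega, by simpa [hjk] using hp⟩
          · exact Or.inl (by simpa [hjk] using hp)

lemma IsBlock.closure_interior {b : Set (ℝ × ℝ)} (hb : IsBlock b) :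
    closure (interior b) = b := by
  obtain ⟨x1, x2, y1, y2, hx, hy, rfl⟩ := hb
  rw [interior_prod_eq, interior_Icc, interior_Icc, closure_prod_eq, closure_Ioo hx.ne,
    closure_Ioo hy.ne]

lemma IsBlock.isClosed {b : Set (ℝ × ℝ)} (hb : IsBlock b) : IsClosed b :=
  hb.closure_interior ▸ isClosed_closure

lemma IsBlock.nonempty {b : Set (ℝ × ℝ)} (hb : IsBlock b) : b.Nonempty := by
  obtain ⟨x1, x2, y1, y2, hx, hy, rfl⟩ := hb
  exact ⟨(x1, y1), ⟨le_rfl, hx.le⟩, le_rfl, hy.le⟩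

/-- The corners left over after a rectangle with lower left vertex `(x, y)` and upper right vertex
a corner of the region is cut off. -/
noncomputable def cutCorners (C : Finset (ℝ × ℝ)) (x y : ℝ) : Finset (ℝ × ℝ) :=
  (C.image (fun c => (min c.1 x, c.2)) ∪ C.image (fun c => (c.1, min c.2 y))).filter
    fun c => 0 < c.1 ∧ 0 < c.2

lemma mem_cutCorners {C : Finset (ℝ × ℝ)} {x y : ℝ} {d : ℝ × ℝ} :
    d ∈ cutCorners C x y ↔
      ((∃ c ∈ C, (min c.1 x, c.2) = d) ∨ ∃ c ∈ C, (c.1, min c.2 y) = d) ∧ 0 < d.1 ∧ 0 < d.2 := by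
  simp only [cutCorners, Finset.mem_filter, Finset.mem_union, Finset.mem_image]

lemma sUnion_erase_eq_cornerRegion {R : Finset (Set (ℝ × ℝ))} {C : Finset (ℝ × ℝ)}
    (hblock : ∀ b ∈ R, IsBlock b)
    (hdisj : ∀ b ∈ R, ∀ b' ∈ R, b ≠ b' → interior b ∩ interior b' = ∅)
    (hU : ⋃₀ (R : Set (Set (ℝ × ℝ))) = cornerRegion C)
    {x1 x2 y1 y2 : ℝ} (hx : x1 < x2) (hy : y1 < y2) (hr : Icc x1 x2 ×ˢ Icc y1 y2 ∈ R)
    (htop : Icc x1 x2 ×ˢ ({y2} : Set ℝ) ⊆ frontier (cornerRegion C))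
    (hright : ({x2} : Set ℝ) ×ˢ Icc y1 y2 ⊆ frontier (cornerRegion C)) :
    ⋃₀ ((R.erase (Icc x1 x2 ×ˢ Icc y1 y2) : Finset _) : Set (Set (ℝ × ℝ))) =
      cornerRegion (cutCorners C x1 y1) := by
  have hsub (b) (hb : b ∈ R) : b ⊆ cornerRegion C := hU ▸ subset_sUnion_of_mem hb
  obtain ⟨-, -, ⟨hx1, -⟩, hy1, -⟩ :=
    mem_cornerRegion.1 (hsub _ hr (mk_mem_prod (left_mem_Icc.2 hx.le) (left_mem_Icc.2 hy.le)))
  dsimp only at hx1 hy1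
  have hcR (c) (hc : c ∈ C) (h1 : x2 < c.1) : c.2 ≤ y1 := by
    by_contra! hlt
    obtain ⟨y, hy1y, hyc⟩ := exists_between (lt_min hy hlt)
    obtain ⟨hyy2, hyc2⟩ := lt_min_iff.1 hyc
    exact (hright (mk_mem_prod (mem_singleton x2) ⟨hy1y.le, hyy2.le⟩)).2
      (mem_interior_cornerRegion hc (hx1.trans_lt hx) h1 (hy1.trans_lt hy1y) hyc2)
  have hcT (c) (hc : c ∈ C) (h2 : y2 < c.2) : c.1 ≤ x1 := by
    by_contra! hlt
    obtain ⟨x, hx1x, hxc⟩ := exists_between (lt_min hx hlt)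
    obtain ⟨hxx2, hxc1⟩ := lt_min_iff.1 hxc
    exact (htop (mk_mem_prod ⟨hx1x.le, hxx2.le⟩ (mem_singleton y2))).2
      (mem_interior_cornerRegion hc (hx1.trans_lt hx1x) hxc1 (hy1.trans_lt hy) h2)
  apply Subset.antisymm
  · refine sUnion_subset fun b hb => ?_
    obtain ⟨hbr, hbR⟩ := Finset.mem_erase.1 hb
    rw [← (hblock b hbR).closure_interior]
    refine closure_minimal (fun q hq => ?_) (isClosed_cornerRegion _)
    have hqr : q ∉ Icc x1 x2 ×ˢ Icc y1 y2 := by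
      have := (disjoint_iff_inter_eq_empty.2 (hdisj b hbR _ hr hbr)).closure_right
        isOpen_interior
      rw [(hblock _ hr).closure_interior] at this
      exact disjoint_left.1 this hq
    have hpos : 0 < q.1 ∧ 0 < q.2 := by
      have hsub' : b ⊆ Ici 0 ×ˢ Ici 0 := fun p hp => by
        obtain ⟨-, -, ⟨p1, -⟩, p2, -⟩ := mem_cornerRegion.1 (hsub b hbR hp)
        exact ⟨p1, p2⟩
      have hq' := interior_mono hsub' hq
      rwa [interior_prod_eq, interior_Ici] at hq'
    obtain ⟨c, hc, ⟨q1, q1'⟩, q2, q2'⟩ := mem_cornerRegion.1 (hsub b hbR (interior_subset hq))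
    have key : q.1 ≤ x1 ∨ q.2 ≤ y1 := by
      by_contra! hcon
      have hq1 : q.1 ≤ x2 := not_lt.1 fun hlt =>
        (hcon.2.trans_le q2').not_ge (hcR c hc (hlt.trans_le q1'))
      have hq2 : q.2 ≤ y2 := not_lt.1 fun hlt =>
        (hcon.1.trans_le q1').not_ge (hcT c hc (hlt.trans_le q2'))
      exact hqr ⟨⟨hcon.1.le, hq1⟩, hcon.2.le, hq2⟩
    rcases key with hk | hk
    · have hm : q.1 ≤ min c.1 x1 := le_min q1' hk
      exact mem_cornerRegion.2 ⟨(min c.1 x1, c.2), mem_cutCorners.2 ⟨Or.inl ⟨c, hc, rfl⟩,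
        hpos.1.trans_le hm, hpos.2.trans_le q2'⟩, ⟨q1, hm⟩, q2, q2'⟩
    · have hm : q.2 ≤ min c.2 y1 := le_min q2' hk
      exact mem_cornerRegion.2 ⟨(c.1, min c.2 y1), mem_cutCorners.2 ⟨Or.inr ⟨c, hc, rfl⟩,
        hpos.1.trans_le q1', hpos.2.trans_le hm⟩, ⟨q1, q1'⟩, q2, hm⟩
  · refine iUnion₂_subset fun d hd => ?_
    obtain ⟨hd', hd1, hd2⟩ := mem_cutCorners.1 hd
    have hcl : closure (Ioo 0 d.1 ×ˢ Ioo 0 d.2) = Icc 0 d.1 ×ˢ Icc 0 d.2 := by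
      rw [closure_prod_eq, closure_Ioo hd1.ne, closure_Ioo hd2.ne]
    rw [← hcl]
    have hclosed : IsClosed
        (⋃₀ ((R.erase (Icc x1 x2 ×ˢ Icc y1 y2) : Finset _) : Set (Set (ℝ × ℝ)))) := by
      rw [sUnion_eq_biUnion]
      exact (Finset.finite_toSet _).isClosed_biUnion fun b hb =>
        (hblock b (Finset.mem_of_mem_erase hb)).isClosed
    refine closure_minimal (fun q ⟨⟨q1, q1'⟩, q2, q2'⟩ => ?_) hclosed
    obtain ⟨hqU, hqr⟩ : q ∈ cornerRegion C ∧ (q.1 < x1 ∨ q.2 < y1) := by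
      rcases hd' with ⟨c, hc, rfl⟩ | ⟨c, hc, rfl⟩
      · obtain ⟨h1, h2⟩ := lt_min_iff.1 q1'
        exact ⟨mem_cornerRegion.2 ⟨c, hc, ⟨q1.le, h1.le⟩, q2.le, q2'.le⟩, Or.inl h2⟩
      · obtain ⟨h1, h2⟩ := lt_min_iff.1 q2'
        exact ⟨mem_cornerRegion.2 ⟨c, hc, ⟨q1.le, q1'.le⟩, q2.le, h1.le⟩, Or.inr h2⟩
    rw [← hU] at hqU
    obtain ⟨b, hb, hqb⟩ := hqU
    refine ⟨b, Finset.mem_erase.2 ⟨?_, hb⟩, hqb⟩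
    rintro rfl
    exact hqr.elim (fun h => h.not_ge hqb.1.1) fun h => h.not_ge hqb.2.1

/-- If `R` is a staircase with at least two blocks and `r` is a
deletable rectangle of `R`, then `R \ {r}` is a staircase. -/
theorem staircase_erase_deletable (R : Finset (Set (ℝ × ℝ)))
    (hR : IsStaircase R) (hcard : 2 ≤ R.card)
    (r : Set (ℝ × ℝ)) (hr : IsDeletable R r) :
    IsStaircase (R.erase r) := by
  obtain ⟨m, a, h, -, hblock, hdisj, hfour, -, ha0, ha, hh, hpos, hU⟩ := hR
  obtain ⟨hrR, x1, x2, y1, y2, hx, hy, rfl, htop, hright⟩ := hr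
  have H : IsStepData m a h := by
    refine ⟨ha0, ha, hh, fun j hj hjm => ?_⟩
    induction hjm using Nat.decreasingInduction with
    | self => exact hpos
    | of_succ k hk ih => exact (ih (by omega)).trans (hh k hj hk)
  rw [H.iUnion_strips] at hU
  rw [hU] at htop hright
  have hE := sUnion_erase_eq_cornerRegion hblock hdisj hU hx hy hrR htop hright
  obtain ⟨m', a', h', H', -, hreg⟩ := exists_isStepData
    (cutCorners _ x1 y1) fun c hc => (mem_cutCorners.1 hc).2
  rw [hreg] at hE
  have hne : (R.erase (Icc x1 x2 ×ˢ Icc y1 y2)).Nonempty := by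
    rw [← Finset.card_pos, Finset.card_erase_of_mem hrR]
    omega
  have hm' : 1 ≤ m' := by
    obtain ⟨b, hb⟩ := hne
    obtain ⟨p, hp⟩ := (hblock b (Finset.mem_of_mem_erase hb)).nonempty
    have hpE := hE.subset ⟨b, hb, hp⟩
    obtain ⟨d, hd, -⟩ := mem_cornerRegion.1 hpE
    obtain ⟨j, hj, -⟩ := Finset.mem_image.1 hd
    have := Finset.mem_Icc.1 hj
    omega
  refine ⟨m', a', h', hne, fun b hb => hblock b (Finset.mem_of_mem_erase hb),
    fun b hb b' hb' => hdisj b (Finset.mem_of_mem_erase hb) b' (Finset.mem_of_mem_erase hb'),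
    fun p b1 b2 b3 b4 h1 h2 h3 h4 => hfour p b1 b2 b3 b4 (Finset.mem_of_mem_erase h1)
      (Finset.mem_of_mem_erase h2) (Finset.mem_of_mem_erase h3) (Finset.mem_of_mem_erase h4),
    hm', H'.zero, H'.lt_succ, H'.succ_lt, H'.pos m' hm' le_rfl, ?_⟩
  rw [hE, H'.iUnion_strips]
end

section
/- If M is a mosaic floorplan whose union is the rectangle [0,W]×[0,H], then M has exactly one deletable rectangle, namely the unique block of M that contains the top-right corner point (W,H). -/
open Set

/-- The frontier of a closed rectangle, described by coordinates. -/
theorem mem_frontier_Icc_prod_Icc {a b c d : ℝ} {p : ℝ × ℝ} :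
    p ∈ frontier (Icc a b ×ˢ Icc c d) ↔
      ((a ≤ p.1 ∧ p.1 ≤ b) ∧ c ≤ p.2 ∧ p.2 ≤ d) ∧
        ¬((a < p.1 ∧ p.1 < b) ∧ c < p.2 ∧ p.2 < d) := by
  rw [(isClosed_Icc.prod isClosed_Icc).frontier_eq, interior_prod_eq, interior_Icc, interior_Icc]
  simp only [mem_sdiff, mem_prod, mem_Icc, mem_Ioo]

/-- Inclusion of nondegenerate rectangles gives inequalities between their sides. -/
theorem bounds_of_Icc_prod_Icc_subset {x1 x2 y1 y2 a b c d : ℝ} (hx : x1 < x2) (hy : y1 < y2)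
    (h : Icc x1 x2 ×ˢ Icc y1 y2 ⊆ Icc a b ×ˢ Icc c d) :
    a ≤ x1 ∧ x2 ≤ b ∧ c ≤ y1 ∧ y2 ≤ d := by
  have lower : ((x1, y1) : ℝ × ℝ) ∈ Icc a b ×ˢ Icc c d :=
    h ⟨left_mem_Icc.2 hx.le, left_mem_Icc.2 hy.le⟩
  have upper : ((x2, y2) : ℝ × ℝ) ∈ Icc a b ×ˢ Icc c d :=
    h ⟨right_mem_Icc.2 hx.le, right_mem_Icc.2 hy.le⟩
  exact ⟨lower.1.1, upper.1.2, lower.2.1, upper.2.2⟩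

/-- A block inside `[0,W] × [0,H]` that contains `(W, H)` has `(W, H)` as its top-right corner. -/
theorem IsBlock.exists_eq_of_corner_mem {b : Set (ℝ × ℝ)} {W H : ℝ} (hb : IsBlock b)
    (hsub : b ⊆ Icc (0 : ℝ) W ×ˢ Icc (0 : ℝ) H) (hmem : ((W, H) : ℝ × ℝ) ∈ b) :
    ∃ x y : ℝ, 0 ≤ x ∧ x < W ∧ 0 ≤ y ∧ y < H ∧ b = Icc x W ×ˢ Icc y H := by
  obtain ⟨x1, x2, y1, y2, hx, hy, rfl⟩ := hb
  obtain ⟨hx1, hx2, hy1, hy2⟩ := bounds_of_Icc_prod_Icc_subset hx hy hsub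
  obtain rfl : x2 = W := le_antisymm hx2 hmem.1.2
  obtain rfl : y2 = H := le_antisymm hy2 hmem.2.2
  exact ⟨x1, y1, hx1, hx, hy1, hy, rfl⟩

/-- If `M` is a mosaic floorplan whose union is the rectangle
`[0,W] × [0,H]`, then `M` has exactly one deletable rectangle, namely the unique
block of `M` containing the top-right corner `(W, H)`. -/
theorem mosaic_unique_deletable (M : Finset (Set (ℝ × ℝ))) (W H : ℝ)
    (hM : IsMosaicFloorplan M)
    (hU : ⋃₀ (M : Set (Set (ℝ × ℝ))) = Icc (0 : ℝ) W ×ˢ Icc (0 : ℝ) H) :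
    (∃! b, b ∈ M ∧ ((W, H) : ℝ × ℝ) ∈ b) ∧
      ∀ r, IsDeletable M r ↔ (r ∈ M ∧ ((W, H) : ℝ × ℝ) ∈ r) := by
  obtain ⟨a, h, hne, hblock, hdisj, -⟩ := hM
  have hsub : ∀ b ∈ M, b ⊆ Icc (0 : ℝ) W ×ˢ Icc (0 : ℝ) H := fun b hb =>
    hU ▸ subset_sUnion_of_mem (Finset.mem_coe.2 hb)
  have hpos : 0 ≤ W ∧ 0 ≤ H := by
    obtain ⟨b, hb⟩ := hne
    obtain ⟨x1, x2, y1, y2, hx, hy, rfl⟩ := hblock b hb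
    obtain ⟨h1, h2, h3, h4⟩ := bounds_of_Icc_prod_Icc_subset hx hy (hsub _ hb)
    exact ⟨by linarith, by linarith⟩
  refine ⟨?_, fun r => ⟨?_, ?_⟩⟩
  · have hcorner : ((W, H) : ℝ × ℝ) ∈ ⋃₀ (M : Set (Set (ℝ × ℝ))) :=
      hU ▸ ⟨right_mem_Icc.2 hpos.1, right_mem_Icc.2 hpos.2⟩
    obtain ⟨b, hb, hWb⟩ := hcorner
    refine ⟨b, ⟨hb, hWb⟩, fun b' ⟨hb', hWb'⟩ => ?_⟩
    by_contra hbb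
    have hempty := hdisj b' hb' b hb hbb
    obtain ⟨x, y, -, hx, -, hy, rfl⟩ := (hblock b hb).exists_eq_of_corner_mem (hsub b hb) hWb
    obtain ⟨x', y', -, hx', -, hy', rfl⟩ :=
      (hblock b' hb').exists_eq_of_corner_mem (hsub b' hb') hWb'
    obtain ⟨s, hs, hsW⟩ := exists_between (max_lt hx hx')
    obtain ⟨t, ht, htH⟩ := exists_between (max_lt hy hy')
    rw [max_lt_iff] at hs ht
    simp only [interior_prod_eq, interior_Icc] at hempty
    have hst : ((s, t) : ℝ × ℝ) ∈ Ioo x' W ×ˢ Ioo y' H ∩ Ioo x W ×ˢ Ioo y H :=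
      ⟨⟨⟨hs.2, hsW⟩, ht.2, htH⟩, ⟨hs.1, hsW⟩, ht.1, htH⟩
    rwa [hempty] at hst
  · rintro ⟨hr, x1, x2, y1, y2, hx, hy, rfl, htop, hright⟩
    refine ⟨hr, ?_⟩
    obtain ⟨hx1, hx2, hy1, hy2⟩ := bounds_of_Icc_prod_Icc_subset hx hy (hsub _ hr)
    rw [hU] at htop hright
    obtain ⟨s, hs1, hs2⟩ := exists_between hx
    obtain ⟨t, ht1, ht2⟩ := exists_between hy
    have hs := (mem_frontier_Icc_prod_Icc.1
      (htop (show ((s, y2) : ℝ × ℝ) ∈ _ from ⟨⟨hs1.le, hs2.le⟩, rfl⟩))).2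
    have ht := (mem_frontier_Icc_prod_Icc.1
      (hright (show ((x2, t) : ℝ × ℝ) ∈ _ from ⟨rfl, ⟨ht1.le, ht2.le⟩⟩))).2
    have hW : W ≤ x2 := by
      by_contra! hlt
      exact ht ⟨⟨by linarith, hlt⟩, by linarith, by linarith⟩
    have hH : H ≤ y2 := by
      by_contra! hlt
      exact hs ⟨⟨by linarith, by linarith⟩, by linarith, hlt⟩
    exact ⟨⟨by linarith, hW⟩, by linarith, hH⟩
  · rintro ⟨hr, hWr⟩
    obtain ⟨x, y, hx0, hx, hy0, hy, rfl⟩ :=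
      (hblock r hr).exists_eq_of_corner_mem (hsub r hr) hWr
    refine ⟨hr, x, W, y, H, hx, hy, rfl, ?_, ?_⟩
    · rintro ⟨s, t⟩ ⟨⟨hs1, hs2⟩, rfl⟩
      rw [hU, mem_frontier_Icc_prod_Icc]
      exact ⟨⟨⟨hx0.trans hs1, hs2⟩, hpos.2, le_rfl⟩, fun h => h.2.2.false⟩
    · rintro ⟨s, t⟩ ⟨rfl, ht1, ht2⟩
      rw [hU, mem_frontier_Icc_prod_Icc]
      exact ⟨⟨⟨hpos.1, le_rfl⟩, hy0.trans ht1, ht2⟩, fun h => h.1.2.false⟩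
end

section
/- Let M be a mosaic floorplan in standard form with n blocks (n ≥ 2). Suppose R_n, R_{n-1}, …, R_1 are sets of blocks and r_n, …, r_2 are blocks such that R_n = M and, for each i with 2 ≤ i ≤ n, r_i is a deletable rectangle of R_i and R_{i-1} = R_i ∖ {r_i}; let r_1 denote the unique block of R_1. Then for every i with 2 ≤ i ≤ n, the block r_{i-1} is adjacent to the block r_i. -/
open Set

/-- A horizontal line segment of positive length. -/
def IsHSeg (s : Set (ℝ × ℝ)) : Prop :=
  ∃ x1 x2 y : ℝ, x1 < x2 ∧ s = Icc x1 x2 ×ˢ ({y} : Set ℝ)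

/-- A vertical line segment of positive length. -/
def IsVSeg (s : Set (ℝ × ℝ)) : Prop :=
  ∃ x y1 y2 : ℝ, y1 < y2 ∧ s = ({x} : Set ℝ) ×ˢ Icc y1 y2

/-- `Γ`, the union of the boundaries of the blocks of `M`. -/
def SegUnion (M : Finset (Set (ℝ × ℝ))) : Set (ℝ × ℝ) :=
  ⋃ b ∈ M, frontier b

/-- A maximal horizontal segment of `M`: a horizontal segment contained in `Γ`
that is maximal with respect to inclusion among such segments. -/
def MaxHSeg (M : Finset (Set (ℝ × ℝ))) (s : Set (ℝ × ℝ)) : Prop :=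
  IsHSeg s ∧ s ⊆ SegUnion M ∧
    ∀ s', IsHSeg s' → s' ⊆ SegUnion M → s ⊆ s' → s' = s

/-- A maximal vertical segment of `M`. -/
def MaxVSeg (M : Finset (Set (ℝ × ℝ))) (s : Set (ℝ × ℝ)) : Prop :=
  IsVSeg s ∧ s ⊆ SegUnion M ∧
    ∀ s', IsVSeg s' → s' ⊆ SegUnion M → s ⊆ s' → s' = s

/-- `M` is in standard form:
* for every maximal horizontal segment `h` (at height `y`), every maximal vertical
  segment intersecting `h` that lies in the closed half-plane above the line of `h`
  has x-coordinate strictly greater than that of every maximal vertical segment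
  intersecting `h` lying in the closed half-plane below that line;
* for every maximal vertical segment `v` (at abscissa `x`), every maximal horizontal
  segment intersecting `v` lying in the closed half-plane to the right of the line
  of `v` has y-coordinate strictly greater than that of every maximal horizontal
  segment intersecting `v` lying in the closed half-plane to the left of that line. -/
def StandardForm (M : Finset (Set (ℝ × ℝ))) : Prop :=
  (∀ x1 x2 y : ℝ, x1 < x2 → MaxHSeg M (Icc x1 x2 ×ˢ ({y} : Set ℝ)) →
    ∀ xa ya1 ya2 : ℝ, ya1 < ya2 → MaxVSeg M (({xa} : Set ℝ) ×ˢ Icc ya1 ya2) →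
      ((({xa} : Set ℝ) ×ˢ Icc ya1 ya2) ∩ (Icc x1 x2 ×ˢ ({y} : Set ℝ))).Nonempty →
      y ≤ ya1 →
    ∀ xb yb1 yb2 : ℝ, yb1 < yb2 → MaxVSeg M (({xb} : Set ℝ) ×ˢ Icc yb1 yb2) →
      ((({xb} : Set ℝ) ×ˢ Icc yb1 yb2) ∩ (Icc x1 x2 ×ˢ ({y} : Set ℝ))).Nonempty →
      yb2 ≤ y →
    xb < xa) ∧
  (∀ x y1 y2 : ℝ, y1 < y2 → MaxVSeg M (({x} : Set ℝ) ×ˢ Icc y1 y2) →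
    ∀ ya xa1 xa2 : ℝ, xa1 < xa2 → MaxHSeg M (Icc xa1 xa2 ×ˢ ({ya} : Set ℝ)) →
      ((Icc xa1 xa2 ×ˢ ({ya} : Set ℝ)) ∩ (({x} : Set ℝ) ×ˢ Icc y1 y2)).Nonempty →
      x ≤ xa1 →
    ∀ yb xb1 xb2 : ℝ, xb1 < xb2 → MaxHSeg M (Icc xb1 xb2 ×ˢ ({yb} : Set ℝ)) →
      ((Icc xb1 xb2 ×ˢ ({yb} : Set ℝ)) ∩ (({x} : Set ℝ) ×ˢ Icc y1 y2)).Nonempty →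
      xb2 ≤ x →
    yb < ya)

/-- Two blocks are adjacent if their intersection is a line segment of positive
length. -/
def Adjacent (b b' : Set (ℝ × ℝ)) : Prop :=
  ∃ s : Set (ℝ × ℝ), (IsHSeg s ∨ IsVSeg s) ∧ b ∩ b' = s

/-- The coordinates of a rectangle `[x₀, x₁] × [y₀, y₁]` dissected into the blocks
`[l i, r i] × [b i, t i]`, no four of which share a point. -/
structure Dissection (ι : Type) where
  (l r b t : ι → ℝ)
  (x₀ x₁ y₀ y₁ : ℝ)
  lr : ∀ i, l i < r i
  bt : ∀ i, b i < t i
  hl : ∀ i, x₀ ≤ l i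
  hr : ∀ i, r i ≤ x₁
  hb : ∀ i, y₀ ≤ b i
  ht : ∀ i, t i ≤ y₁
  cover : ∀ x y, x₀ ≤ x → x ≤ x₁ → y₀ ≤ y → y ≤ y₁ →
    ∃ i, l i ≤ x ∧ x ≤ r i ∧ b i ≤ y ∧ y ≤ t i
  disj : ∀ i j, i ≠ j → r i ≤ l j ∨ r j ≤ l i ∨ t i ≤ b j ∨ t j ≤ b i
  nofour : ∀ x y i j k m,
    (l i ≤ x ∧ x ≤ r i ∧ b i ≤ y ∧ y ≤ t i) → (l j ≤ x ∧ x ≤ r j ∧ b j ≤ y ∧ y ≤ t j) →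
    (l k ≤ x ∧ x ≤ r k ∧ b k ≤ y ∧ y ≤ t k) → (l m ≤ x ∧ x ≤ r m ∧ b m ≤ y ∧ y ≤ t m) →
    i = j ∨ i = k ∨ i = m ∨ j = k ∨ j = m ∨ k = m

namespace Dissection

variable {ι : Type}

/-- Reflection in the diagonal `x = y`. -/
def transpose (F : Dissection ι) : Dissection ι where
  l := F.b
  r := F.t
  b := F.l
  t := F.r
  x₀ := F.y₀
  x₁ := F.y₁
  y₀ := F.x₀
  y₁ := F.x₁
  lr := F.bt
  bt := F.lr
  hl := F.hb
  hr := F.ht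
  hb := F.hl
  ht := F.hr
  cover x y h1 h2 h3 h4 := by
    obtain ⟨i, h⟩ := F.cover y x h3 h4 h1 h2
    exact ⟨i, by tauto⟩
  disj i j h := by have := F.disj i j h; tauto
  nofour x y i j k m h1 h2 h3 h4 :=
    F.nofour y x i j k m (by tauto) (by tauto) (by tauto) (by tauto)

/-- The union of the boundaries of the blocks. -/
def Wall (F : Dissection ι) (x y : ℝ) : Prop :=
  F.x₀ ≤ x ∧ x ≤ F.x₁ ∧ F.y₀ ≤ y ∧ y ≤ F.y₁ ∧
    ∀ i, ¬(F.l i < x ∧ x < F.r i ∧ F.b i < y ∧ y < F.t i)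

theorem wall_transpose {F : Dissection ι} {x y : ℝ} : F.transpose.Wall x y ↔ F.Wall y x := by
  simp only [Wall, transpose]
  constructor <;> rintro ⟨h1, h2, h3, h4, h⟩ <;>
    exact ⟨h3, h4, h1, h2, fun i hi => h i (by tauto)⟩

/-- `[p, q] × {y}` is a nondegenerate segment of the wall. -/
def Seg (F : Dissection ι) (p q y : ℝ) : Prop :=
  p < q ∧ ∀ x, p ≤ x → x ≤ q → F.Wall x y

/-- `[p, q] × {y}` is a maximal horizontal segment of the wall. -/
def MaxSeg (F : Dissection ι) (p q y : ℝ) : Prop :=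
  F.Seg p q y ∧ ∀ p' q', p' ≤ p → q ≤ q' → F.Seg p' q' y → p' = p ∧ q' = q

/-- The condition of standard form on horizontal segments. -/
def Std (F : Dissection ι) : Prop :=
  ∀ p q y, F.MaxSeg p q y →
    ∀ xa ya, F.transpose.MaxSeg y ya xa → p ≤ xa → xa ≤ q →
    ∀ xb yb, F.transpose.MaxSeg yb y xb → p ≤ xb → xb ≤ q → xb < xa

/-- Block `i` is the last one below, and block `j` the first one above, a common maximal
horizontal segment. -/
def Below (F : Dissection ι) (i j : ι) : Prop :=
  F.t i = F.b j ∧ F.MaxSeg (F.l j) (F.r i) (F.t i)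

theorem eq_of_overlap (F : Dissection ι) {i j : ι} (h1 : F.l i < F.r j) (h2 : F.l j < F.r i)
    (h3 : F.b i < F.t j) (h4 : F.b j < F.t i) : i = j := by
  by_contra h
  rcases F.disj i j h with h | h | h | h <;> linarith

theorem wall_of_edge (F : Dissection ι) (i : ι) {x y : ℝ} (h1 : F.l i ≤ x) (h2 : x ≤ F.r i)
    (h : F.b i = y ∨ F.t i = y) : F.Wall x y := by
  have e1 := F.lr i
  have e2 := F.bt i
  have e3 := F.hl i
  have e4 := F.hr i
  have e5 := F.hb i
  have e6 := F.ht i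
  refine ⟨by linarith, by linarith, by rcases h with h | h <;> linarith,
    by rcases h with h | h <;> linarith, fun j hj => ?_⟩
  have : i = j := F.eq_of_overlap (by linarith) (by linarith)
    (by rcases h with h | h <;> linarith) (by rcases h with h | h <;> linarith)
  subst this
  rcases h with h | h <;> linarith

theorem seg_of_edge (F : Dissection ι) (i : ι) {y : ℝ} (h : F.b i = y ∨ F.t i = y) :
    F.Seg (F.l i) (F.r i) y :=
  ⟨F.lr i, fun _ h1 h2 => F.wall_of_edge i h1 h2 h⟩

theorem Seg.union {F : Dissection ι} {p q p' q' y : ℝ} (h : F.Seg p q y) (h' : F.Seg p' q' y)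
    (h1 : p' ≤ p) (h2 : p ≤ q') : F.Seg p' q y := by
  refine ⟨by linarith [h.1], fun x hx hx' => ?_⟩
  rcases le_total x p with hp | hp
  · exact h'.2 x hx (by linarith)
  · exact h.2 x hp hx'

theorem MaxSeg.left_le {F : Dissection ι} {p q p' q' y : ℝ} (h : F.MaxSeg p q y)
    (h' : F.Seg p' q' y) (h2 : p ≤ q') : p ≤ p' := by
  by_contra! hp
  have := (h.2 p' q hp.le le_rfl (h.1.union h' hp.le h2)).1
  linarith

theorem Seg.not_cross {F : Dissection ι} {p q y : ℝ} (h : F.Seg p q y) (i : ι) (h1 : F.l i < q)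
    (h2 : p < F.r i) (h3 : F.b i < y) (h4 : y < F.t i) : False := by
  have hm : max p (F.l i) < min q (F.r i) := max_lt (lt_min h.1 h2) (lt_min h1 (F.lr i))
  have e1 := le_max_left p (F.l i)
  have e2 := le_max_right p (F.l i)
  have e3 := min_le_left q (F.r i)
  have e4 := min_le_right q (F.r i)
  refine (h.2 ((max p (F.l i) + min q (F.r i)) / 2) (by linarith) (by linarith)).2.2.2.2 i
    ⟨?_, ?_, h3, h4⟩ <;> linarith

theorem wall_of_forall_lt {F : Dissection ι} {p q y : ℝ} (hpq : p < q)
    (h : ∀ x, p ≤ x → x < q → F.Wall x y) : F.Wall q y := by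
  obtain ⟨h1, _, h3, h4, _⟩ := h p le_rfl hpq
  refine ⟨by linarith, ?_, h3, h4, fun i hi => ?_⟩
  · by_contra! hq
    have := (h ((max p F.x₁ + q) / 2) (by linarith [le_max_left p F.x₁, max_lt hpq hq])
      (by linarith [max_lt hpq hq])).2.1
    linarith [le_max_right p F.x₁]
  · have hm := max_lt hpq hi.1
    refine (h ((max p (F.l i) + q) / 2) (by linarith [le_max_left p (F.l i)])
      (by linarith)).2.2.2.2 i ⟨?_, ?_, hi.2.2⟩ <;> linarith [le_max_right p (F.l i)]

theorem wall_of_forall_gt {F : Dissection ι} {p q y : ℝ} (hpq : p < q)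
    (h : ∀ x, p < x → x ≤ q → F.Wall x y) : F.Wall p y := by
  obtain ⟨_, h2, h3, h4, _⟩ := h q hpq le_rfl
  refine ⟨?_, by linarith, h3, h4, fun i hi => ?_⟩
  · by_contra! hq
    have hm := lt_min hpq hq
    have := (h ((min q F.x₀ + p) / 2) (by linarith)
      (by linarith [min_le_left q F.x₀])).1
    linarith [min_le_right q F.x₀]
  · have hm := lt_min hpq hi.2.1
    refine (h ((min q (F.r i) + p) / 2) (by linarith)
      (by linarith [min_le_left q (F.r i)])).2.2.2.2 i ⟨?_, ?_, hi.2.2⟩ <;>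
      linarith [min_le_right q (F.r i)]

theorem Seg.exists_maxSeg {F : Dissection ι} {p q y : ℝ} (h : F.Seg p q y) :
    ∃ p' q', p' ≤ p ∧ q ≤ q' ∧ F.MaxSeg p' q' y := by
  set S := {x | F.Seg p x y}
  have hSb : BddAbove S := ⟨F.x₁, fun x hx => (hx.2 x hx.1.le le_rfl).2.1⟩
  have hq : q ≤ sSup S := le_csSup hSb h
  have hlt : ∀ x, p ≤ x → x < sSup S → F.Wall x y := fun x h1 h2 => by
    obtain ⟨s, hs, hxs⟩ := exists_lt_of_lt_csSup ⟨q, h⟩ h2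
    exact hs.2 x h1 hxs.le
  have hpq : p < sSup S := h.1.trans_le hq
  have hseg : F.Seg p (sSup S) y := ⟨hpq, fun x h1 h2 => by
    rcases h2.lt_or_eq with h2 | rfl
    · exact hlt x h1 h2
    · exact wall_of_forall_lt hpq hlt⟩
  set q' := sSup S
  set T := {x | F.Seg x q' y}
  have hTb : BddBelow T := ⟨F.x₀, fun x hx => (hx.2 x le_rfl hx.1.le).1⟩
  have hp : sInf T ≤ p := csInf_le hTb hseg
  have hgt : ∀ x, sInf T < x → x ≤ q' → F.Wall x y := fun x h1 h2 => by
    obtain ⟨s, hs, hxs⟩ := exists_lt_of_csInf_lt ⟨p, hseg⟩ h1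
    exact hs.2 x hxs.le h2
  have hpq' : sInf T < q' := hp.trans_lt hpq
  refine ⟨sInf T, q', hp, hq, ⟨hpq', fun x h1 h2 => ?_⟩, fun p'' q'' h1 h2 h3 => ?_⟩
  · rcases h1.lt_or_eq with h1 | rfl
    · exact hgt x h1 h2
    · exact wall_of_forall_gt hpq' hgt
  · have e : q'' = q' := le_antisymm
      (le_csSup hSb ⟨by linarith, fun x hx hx' => h3.2 x (by linarith) hx'⟩) h2
    subst e
    exact ⟨le_antisymm h1 (csInf_le hTb h3), rfl⟩

theorem Below.left_unique {F : Dissection ι} {i i' j : ι} (h : F.Below i j) (h' : F.Below i' j) :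
    i = i' := by
  obtain ⟨hy, hm⟩ := h
  obtain ⟨hy', hm'⟩ := h'
  have e : F.t i = F.t i' := hy.trans hy'.symm
  rw [← e] at hm'
  have er : F.r i = F.r i' := by
    rcases le_total (F.r i) (F.r i') with hle | hle
    · exact (hm.2 _ _ le_rfl hle hm'.1).2.symm
    · exact (hm'.2 _ _ le_rfl hle hm.1).2
  have := F.lr i
  have := F.lr i'
  have := F.bt i
  have := F.bt i'
  exact F.eq_of_overlap (by linarith) (by linarith) (by linarith) (by linarith)

section Finite

variable [Finite ι]

open Filter Topology in
theorem exists_germ (F : Dissection ι) {x y : ℝ} (s u : ℝ)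
    (h : ∃ δ > 0, ∀ ε, 0 < ε → ε < δ → (F.x₀ ≤ x + s * ε ∧ x + s * ε ≤ F.x₁) ∧
      (F.y₀ ≤ y + u * ε ∧ y + u * ε ≤ F.y₁)) :
    ∃ i, (F.l i ≤ x ∧ x ≤ F.r i ∧ F.b i ≤ y ∧ y ≤ F.t i) ∧ ∃ ε > 0,
      F.l i ≤ x + s * ε ∧ x + s * ε ≤ F.r i ∧ F.b i ≤ y + u * ε ∧ y + u * ε ≤ F.t i := by
  obtain ⟨δ, hδ, h⟩ := h
  have h1 : ∀ᶠ ε in 𝓝[>] (0 : ℝ), ∃ i,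
      F.l i ≤ x + s * ε ∧ x + s * ε ≤ F.r i ∧ F.b i ≤ y + u * ε ∧ y + u * ε ≤ F.t i := by
    filter_upwards [Ioo_mem_nhdsGT hδ] with ε hε
    obtain ⟨h1, h2⟩ := h ε hε.1 hε.2
    exact F.cover _ _ h1.1 h1.2 h2.1 h2.2
  obtain ⟨i, hi⟩ : ∃ i, ∃ᶠ ε in 𝓝[>] (0 : ℝ),
      F.l i ≤ x + s * ε ∧ x + s * ε ≤ F.r i ∧ F.b i ≤ y + u * ε ∧ y + u * ε ≤ F.t i := by
    by_contra hc
    simp only [not_exists, not_frequently] at hc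
    have h2 := (eventually_all.2 hc).and h1
    obtain ⟨ε, h3, i, h4⟩ := h2.exists
    exact h3 i h4
  refine ⟨i, ?_, ?_⟩
  · have hcl : IsClosed (Icc (F.l i) (F.r i) ×ˢ Icc (F.b i) (F.t i)) :=
      isClosed_Icc.prod isClosed_Icc
    have ht : Tendsto (fun ε : ℝ => (x + s * ε, y + u * ε)) (𝓝[>] 0) (𝓝 (x, y)) := by
      refine Tendsto.mono_left ?_ nhdsWithin_le_nhds
      have : Continuous (fun ε : ℝ => (x + s * ε, y + u * ε)) := by fun_prop
      simpa using this.tendsto 0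
    have := hcl.mem_of_frequently_of_tendsto
      (hi.mono fun ε hε => mk_mem_prod ⟨hε.1, hε.2.1⟩ ⟨hε.2.2.1, hε.2.2.2⟩) ht
    exact ⟨this.1.1, this.1.2, this.2.1, this.2.2⟩
  · obtain ⟨ε, h1, h2⟩ := (hi.and_eventually self_mem_nhdsWithin).exists
    exact ⟨ε, h2, h1⟩

theorem exists_upper_right (F : Dissection ι) {x y : ℝ} (h1 : F.x₀ ≤ x) (h2 : x < F.x₁)
    (h3 : F.y₀ ≤ y) (h4 : y < F.y₁) : ∃ i, F.l i ≤ x ∧ x < F.r i ∧ F.b i ≤ y ∧ y < F.t i := by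
  obtain ⟨i, hi, ε, hε, hi'⟩ := F.exists_germ (x := x) (y := y) 1 1
    ⟨min (F.x₁ - x) (F.y₁ - y), by simp [h2, h4], fun ε h5 h6 => by
      rw [lt_min_iff] at h6
      refine ⟨⟨?_, ?_⟩, ?_, ?_⟩ <;> linarith⟩
  refine ⟨i, ?_, ?_, ?_, ?_⟩ <;> linarith

theorem exists_upper_left (F : Dissection ι) {x y : ℝ} (h1 : F.x₀ < x) (h2 : x ≤ F.x₁)
    (h3 : F.y₀ ≤ y) (h4 : y < F.y₁) : ∃ i, F.l i < x ∧ x ≤ F.r i ∧ F.b i ≤ y ∧ y < F.t i := by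
  obtain ⟨i, hi, ε, hε, hi'⟩ := F.exists_germ (x := x) (y := y) (-1) 1
    ⟨min (x - F.x₀) (F.y₁ - y), by simp [h1, h4], fun ε h5 h6 => by
      rw [lt_min_iff] at h6
      refine ⟨⟨?_, ?_⟩, ?_, ?_⟩ <;> linarith⟩
  refine ⟨i, ?_, ?_, ?_, ?_⟩ <;> linarith

theorem exists_lower_left (F : Dissection ι) {x y : ℝ} (h1 : F.x₀ < x) (h2 : x ≤ F.x₁)
    (h3 : F.y₀ < y) (h4 : y ≤ F.y₁) : ∃ i, F.l i < x ∧ x ≤ F.r i ∧ F.b i < y ∧ y ≤ F.t i := by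
  obtain ⟨i, hi, ε, hε, hi'⟩ := F.exists_germ (x := x) (y := y) (-1) (-1)
    ⟨min (x - F.x₀) (y - F.y₀), by simp [h1, h3], fun ε h5 h6 => by
      rw [lt_min_iff] at h6
      refine ⟨⟨?_, ?_⟩, ?_, ?_⟩ <;> linarith⟩
  refine ⟨i, ?_, ?_, ?_, ?_⟩ <;> linarith

theorem exists_lower_right (F : Dissection ι) {x y : ℝ} (h1 : F.x₀ ≤ x) (h2 : x < F.x₁)
    (h3 : F.y₀ < y) (h4 : y ≤ F.y₁) : ∃ i, F.l i ≤ x ∧ x < F.r i ∧ F.b i < y ∧ y ≤ F.t i := by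
  obtain ⟨i, h⟩ := F.transpose.exists_upper_left h3 h4 h1 h2
  exact ⟨i, h.2.2.1, h.2.2.2, h.1, h.2.1⟩

/-- Of the four quadrants at an interior point, two neighbouring ones lie in the same block. -/
theorem exists_straddling (F : Dissection ι) {x y : ℝ} (h1 : F.x₀ < x) (h2 : x < F.x₁)
    (h3 : F.y₀ < y) (h4 : y < F.y₁) :
    (∃ i, F.l i < x ∧ x < F.r i ∧ F.b i ≤ y ∧ y < F.t i) ∨
    (∃ i, F.l i < x ∧ x < F.r i ∧ F.b i < y ∧ y ≤ F.t i) ∨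
    (∃ i, F.l i ≤ x ∧ x < F.r i ∧ F.b i < y ∧ y < F.t i) ∨
    (∃ i, F.l i < x ∧ x ≤ F.r i ∧ F.b i < y ∧ y < F.t i) := by
  obtain ⟨i, hi⟩ := F.exists_upper_right h1.le h2 h3.le h4
  obtain ⟨j, hj⟩ := F.exists_upper_left h1 h2.le h3.le h4
  obtain ⟨k, hk⟩ := F.exists_lower_left h1 h2.le h3 h4.le
  obtain ⟨m, hm⟩ := F.exists_lower_right h1.le h2 h3 h4.le
  have := F.nofour x y i j k m ⟨hi.1, hi.2.1.le, hi.2.2.1, hi.2.2.2.le⟩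
    ⟨hj.1.le, hj.2.1, hj.2.2.1, hj.2.2.2.le⟩ ⟨hk.1.le, hk.2.1, hk.2.2.1.le, hk.2.2.2⟩
    ⟨hm.1, hm.2.1.le, hm.2.2.1.le, hm.2.2.2⟩
  rcases this with rfl | rfl | rfl | rfl | rfl | rfl
  · exact Or.inl ⟨i, by tauto⟩
  · exact Or.inl ⟨i, by tauto⟩
  · exact Or.inr (Or.inr (Or.inl ⟨i, by tauto⟩))
  · exact Or.inr (Or.inr (Or.inr ⟨j, by tauto⟩))
  · exact Or.inl ⟨j, by tauto⟩
  · exact Or.inr (Or.inl ⟨k, by tauto⟩)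

/-- Segments of the wall do not cross. -/
theorem Seg.not_cross_seg {F : Dissection ι} {p q y p' q' x : ℝ} (h : F.Seg p q y)
    (h' : F.transpose.Seg p' q' x) (h1 : p < x) (h2 : x < q) (h3 : p' < y) (h4 : y < q') :
    False := by
  have e1 := (h.2 p le_rfl h.1.le).1
  have e2 := (h.2 q h.1.le le_rfl).2.1
  have e3 := (h'.2 p' le_rfl h'.1.le).1
  have e4 := (h'.2 q' h'.1.le le_rfl).2.1
  simp only [transpose] at e3 e4
  rcases F.exists_straddling (x := x) (y := y) (by linarith) (by linarith) (by linarith)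
    (by linarith) with ⟨i, hi⟩ | ⟨i, hi⟩ | ⟨i, hi⟩ | ⟨i, hi⟩
  · exact h'.not_cross i (hi.2.2.1.trans_lt h4) (h3.trans hi.2.2.2) hi.1 hi.2.1
  · exact h'.not_cross i (hi.2.2.1.trans h4) (h3.trans_le hi.2.2.2) hi.1 hi.2.1
  · exact h.not_cross i (hi.1.trans_lt h2) (h1.trans hi.2.1) hi.2.2.1 hi.2.2.2
  · exact h.not_cross i (hi.1.trans h2) (h1.trans_le hi.2.1) hi.2.2.1 hi.2.2.2

theorem exists_below (F : Dissection ι) (i : ι) (ht : F.t i < F.y₁)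
    (h : F.r i = F.x₁ ∨ ∃ d, F.l d ≤ F.r i ∧ F.r i < F.r d ∧ F.b d < F.t i ∧ F.t i < F.t d) :
    ∃ j, F.Below i j := by
  obtain ⟨p, q, hp, hq, hm⟩ := (F.seg_of_edge i (Or.inr rfl)).exists_maxSeg
  have e1 := F.lr i
  have e2 := F.hr i
  have e3 := F.hb i
  have e4 := F.bt i
  obtain rfl : q = F.r i := by
    refine le_antisymm ?_ hq
    rcases h with h | ⟨d, h1, h2, h3, h4⟩
    · rw [h]
      exact (hm.1.2 q hm.1.1.le le_rfl).2.1
    · by_contra! hlt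
      exact hm.1.not_cross d (by linarith) (by linarith) h3 h4
  obtain ⟨c, h1, h2, h3, h4⟩ := F.exists_upper_right (x := p) (y := F.t i)
    (hm.1.2 p le_rfl hm.1.1.le).1 (by linarith) (by linarith) ht
  have hb : F.b c = F.t i := by
    refine le_antisymm h3 ?_
    by_contra! hlt
    exact hm.1.not_cross c (by linarith) (by linarith) hlt h4
  have hl : F.l c = p := le_antisymm h1 (hm.left_le (F.seg_of_edge c (Or.inl hb)) h2.le)
  exact ⟨c, hb.symm, hl ▸ hm⟩

theorem exists_below_or_left (F : Dissection ι) (i : ι) (h : ¬(F.r i = F.x₁ ∧ F.t i = F.y₁)) :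
    ∃ j, F.Below i j ∨ F.transpose.Below i j := by
  have e1 := F.lr i
  have e2 := F.bt i
  have e3 := F.hl i
  have e4 := F.hb i
  rcases (F.hr i).lt_or_eq with hr | hr
  · rcases (F.ht i).lt_or_eq with ht | ht
    · rcases F.exists_straddling (x := F.r i) (y := F.t i) (by linarith) hr (by linarith) ht with
        ⟨d, hd⟩ | ⟨d, hd⟩ | ⟨d, hd⟩ | ⟨d, hd⟩
      · obtain ⟨j, hj⟩ := F.transpose.exists_below i hr
          (Or.inr ⟨d, hd.2.2.1, hd.2.2.2, hd.1, hd.2.1⟩)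
        exact ⟨j, Or.inr hj⟩
      · obtain rfl := F.eq_of_overlap (i := i) (j := d) (by linarith) (by linarith)
          (by linarith) (by linarith)
        linarith
      · obtain ⟨j, hj⟩ := F.exists_below i ht (Or.inr ⟨d, hd⟩)
        exact ⟨j, Or.inl hj⟩
      · obtain rfl := F.eq_of_overlap (i := i) (j := d) (by linarith) (by linarith)
          (by linarith) (by linarith)
        linarith
    · obtain ⟨j, hj⟩ := F.transpose.exists_below i hr (Or.inl ht)
      exact ⟨j, Or.inr hj⟩
  · obtain ⟨j, hj⟩ := F.exists_below i (lt_of_le_of_ne (F.ht i) fun ht => h ⟨hr, ht⟩) (Or.inl hr)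
    exact ⟨j, Or.inl hj⟩

theorem Below.left_lt_right {F : Dissection ι} (hF : F.Std) {i j : ι} (h : F.Below i j) :
    F.l i < F.r j := by
  obtain ⟨hy, hm⟩ := h
  by_contra! hle
  have ei := F.lr i
  have ej := F.lr j
  have ei' := F.bt i
  have ej' := F.bt j
  obtain ⟨p, q, hp, hq, hv⟩ := (F.transpose.seg_of_edge j (Or.inr rfl)).exists_maxSeg
  obtain ⟨p', q', hp', hq', hv'⟩ := (F.transpose.seg_of_edge i (Or.inl rfl)).exists_maxSeg
  simp only [transpose] at hp hq hp' hq' hv hv'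
  obtain rfl : p = F.t i := by
    by_contra hne
    exact hm.1.not_cross_seg hv.1 (by linarith) (by linarith)
      (lt_of_le_of_ne (hy ▸ hp) hne) (by linarith)
  obtain rfl : q' = F.t i := by
    by_contra hne
    exact hm.1.not_cross_seg hv'.1 (by linarith) (by linarith) (by linarith)
      (lt_of_le_of_ne hq' (Ne.symm hne))
  have := hF _ _ _ hm _ _ hv (by linarith) (by linarith) _ _ hv' (by linarith) (by linarith)
  linarith

theorem Below.not_transpose {F : Dissection ι} {i i' j : ι} (h : F.Below i j)
    (h' : F.transpose.Below i' j) : False := by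
  obtain ⟨hy, hm⟩ := h
  obtain ⟨hx, hv⟩ := h'
  rw [hy] at hm
  rw [hx] at hv
  have e1 := F.lr i'
  have e2 := F.bt i
  have e3 := F.hl i'
  have e4 := F.hb i
  have e5 := F.lr j
  have e6 := F.bt j
  have e7 := F.hr j
  have e8 := F.ht j
  simp only [transpose] at hx hv
  rcases F.exists_straddling (x := F.l j) (y := F.b j) (by linarith) (by linarith) (by linarith)
    (by linarith) with ⟨d, hd⟩ | ⟨d, hd⟩ | ⟨d, hd⟩ | ⟨d, hd⟩
  · obtain rfl := F.eq_of_overlap (i := j) (j := d) (by linarith) (by linarith)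
      (by linarith) (by linarith)
    linarith
  · have hd' : F.t d = F.b j := by
      refine le_antisymm ?_ hd.2.2.2
      by_contra! hlt
      obtain rfl := F.eq_of_overlap (i := j) (j := d) (by linarith) (by linarith)
        (by linarith) (by linarith)
      linarith
    have := hm.left_le (F.seg_of_edge d (Or.inr hd')) hd.2.1.le
    linarith
  · obtain rfl := F.eq_of_overlap (i := j) (j := d) (by linarith) (by linarith)
      (by linarith) (by linarith)
    linarith
  · have hd' : F.r d = F.l j := by
      refine le_antisymm ?_ hd.2.1
      by_contra! hlt
      obtain rfl := F.eq_of_overlap (i := j) (j := d) (by linarith) (by linarith)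
        (by linarith) (by linarith)
      linarith
    have := hv.left_le (F.transpose.seg_of_edge d (Or.inr hd')) hd.2.2.2.le
    simp only [transpose] at this
    linarith

end Finite

end Dissection

/-- `F` records the coordinates of the blocks of `M`. -/
def Dissection.IsCoords {M : Finset (Set (ℝ × ℝ))} (F : Dissection M) : Prop :=
  ∀ i : M, (i : Set (ℝ × ℝ)) = Icc (F.l i) (F.r i) ×ˢ Icc (F.b i) (F.t i)

theorem IsMosaicFloorplan.exists_dissection {M : Finset (Set (ℝ × ℝ))}
    (hM : IsMosaicFloorplan M) : ∃ F : Dissection M, F.IsCoords := by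
  obtain ⟨a, h, -, hblock, hdisj, hfour, -, -, -, -, -, hU⟩ := hM
  choose! l r b t hlr hbt heq using hblock
  simp only [Finset.Icc_self, Finset.mem_singleton, iUnion_iUnion_eq_left] at hU
  have hin : ∀ c ∈ M, ∀ p ∈ c, p ∈ Icc (a (1 - 1)) (a 1) ×ˢ Icc (0 : ℝ) (h 1) :=
    fun c hc p hp => hU ▸ mem_sUnion_of_mem hp hc
  have hmem : ∀ (c : M) (x y : ℝ), l c ≤ x ∧ x ≤ r c ∧ b c ≤ y ∧ y ≤ t c ↔
      (x, y) ∈ (c : Set (ℝ × ℝ)) := fun c x y => by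
    conv_rhs => rw [heq c c.2]
    simp only [mem_prod, mem_Icc]
    tauto
  have hlb : ∀ c ∈ M, (l c, b c) ∈ Icc (a (1 - 1)) (a 1) ×ˢ Icc (0 : ℝ) (h 1) := fun c hc =>
    hin c hc _ ((hmem ⟨c, hc⟩ _ _).1 ⟨le_rfl, (hlr c hc).le, le_rfl, (hbt c hc).le⟩)
  have hrt : ∀ c ∈ M, (r c, t c) ∈ Icc (a (1 - 1)) (a 1) ×ˢ Icc (0 : ℝ) (h 1) := fun c hc =>
    hin c hc _ ((hmem ⟨c, hc⟩ _ _).1 ⟨(hlr c hc).le, le_rfl, (hbt c hc).le, le_rfl⟩)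
  refine ⟨⟨fun c => l c, fun c => r c, fun c => b c, fun c => t c, a (1 - 1), a 1, 0, h 1,
    fun c => hlr c c.2, fun c => hbt c c.2, fun c => (hlb c c.2).1.1, fun c => (hrt c c.2).1.2,
    fun c => (hlb c c.2).2.1, fun c => (hrt c c.2).2.2, fun x y h1 h2 h3 h4 => ?_,
    fun i j hij => ?_, fun x y i j k m hi hj hk hm => ?_⟩, fun c => heq c c.2⟩
  · have : (x, y) ∈ ⋃₀ (M : Set (Set (ℝ × ℝ))) := hU ▸ ⟨⟨h1, h2⟩, h3, h4⟩
    obtain ⟨c, hc, hxy⟩ := this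
    exact ⟨⟨c, hc⟩, (hmem ⟨c, hc⟩ x y).2 hxy⟩
  · by_contra! hc
    have hi := hdisj i i.2 j j.2 (Subtype.coe_ne_coe.2 hij)
    rw [heq i i.2, heq j j.2] at hi
    simp only [interior_prod_eq, interior_Icc] at hi
    obtain ⟨x, hx, hx'⟩ := exists_between
      (max_lt (lt_min (hlr i i.2) hc.2.1) (lt_min hc.1 (hlr j j.2)))
    obtain ⟨y, hy, hy'⟩ := exists_between
      (max_lt (lt_min (hbt i i.2) hc.2.2.2) (lt_min hc.2.2.1 (hbt j j.2)))
    rw [max_lt_iff] at hx hy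
    rw [lt_min_iff] at hx' hy'
    exact eq_empty_iff_forall_notMem.1 hi (x, y)
      ⟨⟨⟨hx.1, hx'.1⟩, hy.1, hy'.1⟩, ⟨hx.2, hx'.2⟩, hy.2, hy'.2⟩
  · simp only [← Subtype.coe_inj]
    rw [hmem] at hi hj hk hm
    exact hfour (x, y) _ _ _ _ i.2 j.2 k.2 m.2 hi hj hk hm

namespace Dissection.IsCoords

variable {M : Finset (Set (ℝ × ℝ))} {F : Dissection M}

theorem mem_iff (hF : F.IsCoords) (i : M) (x y : ℝ) :
    (x, y) ∈ (i : Set (ℝ × ℝ)) ↔ F.l i ≤ x ∧ x ≤ F.r i ∧ F.b i ≤ y ∧ y ≤ F.t i := by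
  rw [hF i]
  simp only [mem_prod, mem_Icc]
  tauto

theorem mem_frontier_iff (hF : F.IsCoords) (i : M) (x y : ℝ) : (x, y) ∈ frontier (i : Set (ℝ × ℝ)) ↔
    (F.l i ≤ x ∧ x ≤ F.r i ∧ F.b i ≤ y ∧ y ≤ F.t i) ∧
      ¬(F.l i < x ∧ x < F.r i ∧ F.b i < y ∧ y < F.t i) := by
  rw [hF i, (isClosed_Icc.prod isClosed_Icc).frontier_eq, interior_prod_eq, interior_Icc,
    interior_Icc]
  simp only [mem_sdiff, mem_prod, mem_Icc, mem_Ioo]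
  tauto

theorem mem_segUnion_iff (hF : F.IsCoords) (x y : ℝ) : (x, y) ∈ SegUnion M ↔ F.Wall x y := by
  simp only [SegUnion, mem_iUnion, exists_prop]
  constructor
  · rintro ⟨c, hc, h⟩
    obtain ⟨h, h'⟩ := (hF.mem_frontier_iff ⟨c, hc⟩ x y).1 h
    have e1 := F.hl ⟨c, hc⟩
    have e2 := F.hr ⟨c, hc⟩
    have e3 := F.hb ⟨c, hc⟩
    have e4 := F.ht ⟨c, hc⟩
    refine ⟨by linarith, by linarith, by linarith, by linarith, fun j hj => ?_⟩
    obtain rfl := F.eq_of_overlap (i := j) (j := ⟨c, hc⟩) (by linarith) (by linarith)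
      (by linarith) (by linarith)
    exact h' hj
  · rintro ⟨h1, h2, h3, h4, h⟩
    obtain ⟨i, hi⟩ := F.cover x y h1 h2 h3 h4
    exact ⟨i, i.2, (hF.mem_frontier_iff i x y).2 ⟨hi, h i⟩⟩

theorem maxHSeg (hF : F.IsCoords) {p q y : ℝ} (h : F.MaxSeg p q y) :
    MaxHSeg M (Icc p q ×ˢ ({y} : Set ℝ)) := by
  refine ⟨⟨p, q, y, h.1.1, rfl⟩, ?_, ?_⟩
  · rintro ⟨x, _⟩ ⟨hx, rfl⟩
    exact (hF.mem_segUnion_iff _ _).2 (h.1.2 x hx.1 hx.2)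
  · rintro _ ⟨p', q', y', hpq, rfl⟩ hG hs
    have hp := hs (mk_mem_prod (left_mem_Icc.2 h.1.1.le) (mem_singleton y))
    have hq := hs (mk_mem_prod (right_mem_Icc.2 h.1.1.le) (mem_singleton y))
    obtain rfl : y = y' := hp.2
    obtain ⟨rfl, rfl⟩ := h.2 p' q' hp.1.1 hq.1.2
      ⟨hpq, fun x h1 h2 => (hF.mem_segUnion_iff _ _).1 (hG ⟨⟨h1, h2⟩, rfl⟩)⟩
    rfl

theorem maxVSeg (hF : F.IsCoords) {p q x : ℝ} (h : F.transpose.MaxSeg p q x) :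
    MaxVSeg M (({x} : Set ℝ) ×ˢ Icc p q) := by
  refine ⟨⟨x, p, q, h.1.1, rfl⟩, ?_, ?_⟩
  · rintro ⟨_, y⟩ ⟨rfl, hy⟩
    exact (hF.mem_segUnion_iff _ _).2 (wall_transpose.1 (h.1.2 y hy.1 hy.2))
  · rintro _ ⟨x', p', q', hpq, rfl⟩ hG hs
    have hp := hs (mk_mem_prod (mem_singleton x) (left_mem_Icc.2 h.1.1.le))
    have hq := hs (mk_mem_prod (mem_singleton x) (right_mem_Icc.2 h.1.1.le))
    obtain rfl : x = x' := hp.1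
    obtain ⟨rfl, rfl⟩ := h.2 p' q' hp.2.1 hq.2.2 ⟨hpq, fun y h1 h2 =>
      wall_transpose.2 ((hF.mem_segUnion_iff _ _).1 (hG ⟨rfl, h1, h2⟩))⟩
    rfl

theorem std (hF : F.IsCoords) (h : StandardForm M) : F.Std :=
  fun p q y hm xa ya ha h1 h2 xb yb hb h3 h4 =>
  h.1 p q y hm.1.1 (hF.maxHSeg hm) xa y ya ha.1.1 (hF.maxVSeg ha)
    ⟨(xa, y), ⟨rfl, left_mem_Icc.2 ha.1.1.le⟩, ⟨h1, h2⟩, rfl⟩ le_rfl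
    xb yb y hb.1.1 (hF.maxVSeg hb)
    ⟨(xb, y), ⟨rfl, right_mem_Icc.2 hb.1.1.le⟩, ⟨h3, h4⟩, rfl⟩ le_rfl

theorem std_transpose (hF : F.IsCoords) (h : StandardForm M) : F.transpose.Std :=
  fun p q x hm ya xa ha h1 h2 yb xb hb h3 h4 =>
  h.2 x p q hm.1.1 (hF.maxVSeg hm) ya x xa ha.1.1 (hF.maxHSeg ha)
    ⟨(x, ya), ⟨⟨le_rfl, ha.1.1.le⟩, rfl⟩, rfl, h1, h2⟩ le_rfl
    yb xb x hb.1.1 (hF.maxHSeg hb)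
    ⟨(x, yb), ⟨⟨hb.1.1.le, le_rfl⟩, rfl⟩, rfl, h3, h4⟩ le_rfl

theorem not_isDeletable_of_above (hF : F.IsCoords) {R : Finset (Set (ℝ × ℝ))} {i j : M}
    (hi : (i : Set (ℝ × ℝ)) ∈ R)
    (hj : (j : Set (ℝ × ℝ)) ∈ R) (h : F.t i = F.b j) (h1 : F.l i < F.r j)
    (h2 : F.l j < F.r i) : ¬IsDeletable R i := by
  rintro ⟨-, x1, x2, y1, y2, hx, hy, heq, htop, -⟩
  rw [hF i, Icc_prod_Icc, Icc_prod_Icc,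
    Icc_eq_Icc_iff (Prod.mk_le_mk.2 ⟨(F.lr i).le, (F.bt i).le⟩)] at heq
  obtain ⟨h3, h4⟩ := heq
  obtain ⟨rfl, rfl⟩ := Prod.mk.inj h3
  obtain ⟨rfl, rfl⟩ := Prod.mk.inj h4
  obtain ⟨x, hx1, hx2⟩ := exists_between
    (max_lt (lt_min (F.lr i) h1) (lt_min h2 (F.lr j)))
  rw [max_lt_iff] at hx1
  rw [lt_min_iff] at hx2
  have hfr := htop (mk_mem_prod ⟨hx1.1.le, hx2.1.le⟩ (mem_singleton (F.t i)))
  refine hfr.2 (mem_interior.2 ⟨Ioo (max (F.l i) (F.l j)) (min (F.r i) (F.r j)) ×ˢ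
    Ioo (F.b i) (F.t j), ?_, isOpen_Ioo.prod isOpen_Ioo, ?_⟩)
  · rintro ⟨u, v⟩ ⟨⟨hu, hu'⟩, hv, hv'⟩
    simp only [max_lt_iff, lt_min_iff] at hu hu' hv hv'
    rcases le_total v (F.t i) with hvt | hvt
    · exact ⟨i, hi, (hF.mem_iff i u v).2 ⟨hu.1.le, hu'.1.le, hv.le, hvt⟩⟩
    · exact ⟨j, hj, (hF.mem_iff j u v).2 ⟨hu.2.le, hu'.2.le, h ▸ hvt, hv'.le⟩⟩
  · exact ⟨⟨max_lt hx1.1 hx1.2, lt_min hx2.1 hx2.2⟩, F.bt i, h ▸ F.bt j⟩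

theorem not_isDeletable_of_right (hF : F.IsCoords) {R : Finset (Set (ℝ × ℝ))} {i j : M}
    (hi : (i : Set (ℝ × ℝ)) ∈ R)
    (hj : (j : Set (ℝ × ℝ)) ∈ R) (h : F.r i = F.l j) (h1 : F.b i < F.t j)
    (h2 : F.b j < F.t i) : ¬IsDeletable R i := by
  rintro ⟨-, x1, x2, y1, y2, hx, hy, heq, -, hright⟩
  rw [hF i, Icc_prod_Icc, Icc_prod_Icc,
    Icc_eq_Icc_iff (Prod.mk_le_mk.2 ⟨(F.lr i).le, (F.bt i).le⟩)] at heq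
  obtain ⟨h3, h4⟩ := heq
  obtain ⟨rfl, rfl⟩ := Prod.mk.inj h3
  obtain ⟨rfl, rfl⟩ := Prod.mk.inj h4
  obtain ⟨y, hy1, hy2⟩ := exists_between
    (max_lt (lt_min (F.bt i) h1) (lt_min h2 (F.bt j)))
  rw [max_lt_iff] at hy1
  rw [lt_min_iff] at hy2
  have hfr := hright (mk_mem_prod (mem_singleton (F.r i)) ⟨hy1.1.le, hy2.1.le⟩)
  refine hfr.2 (mem_interior.2 ⟨Ioo (F.l i) (F.r j) ×ˢ
    Ioo (max (F.b i) (F.b j)) (min (F.t i) (F.t j)), ?_, isOpen_Ioo.prod isOpen_Ioo, ?_⟩)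
  · rintro ⟨u, v⟩ ⟨⟨hu, hu'⟩, hv, hv'⟩
    simp only [max_lt_iff, lt_min_iff] at hu hu' hv hv'
    rcases le_total u (F.r i) with hur | hur
    · exact ⟨i, hi, (hF.mem_iff i u v).2 ⟨hu.le, hur, hv.1.le, hv'.1.le⟩⟩
    · exact ⟨j, hj, (hF.mem_iff j u v).2 ⟨h ▸ hur, hu'.le, hv.2.le, hv'.2.le⟩⟩
  · exact ⟨⟨F.lr i, h ▸ F.lr j⟩, max_lt hy1.1 hy1.2, lt_min hy2.1 hy2.2⟩

theorem adjacent_of_above (hF : F.IsCoords) {i j : M} (h : F.t i = F.b j) (h1 : F.l i < F.r j)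
    (h2 : F.l j < F.r i) : Adjacent (i : Set (ℝ × ℝ)) j := by
  refine ⟨_, Or.inl ⟨max (F.l i) (F.l j), min (F.r i) (F.r j), F.t i,
    max_lt (lt_min (F.lr i) h1) (lt_min h2 (F.lr j)), rfl⟩, ?_⟩
  rw [hF i, hF j, prod_inter_prod, Icc_inter_Icc, Icc_inter_Icc]
  have e : F.t i ≤ F.t j := h ▸ (F.bt j).le
  rw [← h, max_eq_right (F.bt i).le, min_eq_left e, Icc_self]

theorem adjacent_of_right (hF : F.IsCoords) {i j : M} (h : F.r i = F.l j) (h1 : F.b i < F.t j)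
    (h2 : F.b j < F.t i) : Adjacent (i : Set (ℝ × ℝ)) j := by
  refine ⟨_, Or.inr ⟨F.r i, max (F.b i) (F.b j), min (F.t i) (F.t j),
    max_lt (lt_min (F.bt i) h1) (lt_min h2 (F.bt j)), rfl⟩, ?_⟩
  rw [hF i, hF j, prod_inter_prod, Icc_inter_Icc, Icc_inter_Icc]
  have e : F.r i ≤ F.r j := h ▸ (F.lr j).le
  rw [← h, max_eq_right (F.lr i).le, min_eq_left e, Icc_self]

end Dissection.IsCoords

/-- An injective relation on `{1, …, n}` which relates every `k < n` to some larger number is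
the successor relation. -/
theorem rel_succ_of_leftUnique {n : ℕ} {P : ℕ → ℕ → Prop}
    (hP : ∀ k, 1 ≤ k → k < n → ∃ m, k < m ∧ m ≤ n ∧ P k m)
    (hinj : ∀ k k' m, 1 ≤ k → k < k' → k' < n → P k m → ¬P k' m) :
    ∀ k, 1 ≤ k → k < n → P k (k + 1) := by
  suffices ∀ d k, n = k + d → 1 ≤ k → k < n → P k (k + 1) from
    fun k h1 h2 => this (n - k) k (by omega) h1 h2
  intro d
  induction d using Nat.strong_induction_on with
  | _ d ih =>
    intro k hd h1 h2
    obtain ⟨m, hkm, hmn, hm⟩ := hP k h1 h2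
    obtain rfl | hlt := (Nat.succ_le_of_lt hkm).eq_or_lt
    · exact hm
    · have h3 := ih (n - (m - 1)) (by omega) (m - 1) (by omega) (by omega) (by omega)
      rw [Nat.sub_add_cancel (by omega)] at h3
      exact absurd h3 (hinj k (m - 1) m h1 (by omega) (by omega) hm)

/-- The set that remains after deleting `r n, …, r (k + 1)` is `{r 1, …, r k}`. -/
theorem mem_iff_of_erase {α : Type*} [DecidableEq α] {n : ℕ} {R : ℕ → Finset α} {r : ℕ → α}
    (hcard : (R n).card = n) (hmem : ∀ i, 2 ≤ i → i ≤ n → r i ∈ R i)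
    (hprev : ∀ i, 2 ≤ i → i ≤ n → R (i - 1) = (R i).erase (r i)) (hr1 : r 1 ∈ R 1) :
    ∀ k, 1 ≤ k → k ≤ n → ∀ c, c ∈ R k ↔ ∃ j, 1 ≤ j ∧ j ≤ k ∧ r j = c := by
  have hc : ∀ d, d < n → (R (n - d)).card = n - d := by
    intro d
    induction d with
    | zero => exact fun _ => hcard
    | succ d ih =>
      intro hd
      rw [← Nat.sub_sub, hprev (n - d) (by omega) (by omega),
        Finset.card_erase_of_mem (hmem _ (by omega) (by omega)), ih (by omega)]
  intro k hk
  induction k, hk using Nat.le_induction with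
  | base =>
    intro hn c
    obtain ⟨x, hx⟩ := Finset.card_eq_one.1
      (show (R 1).card = 1 by simpa [Nat.sub_sub_self hn] using hc (n - 1) (by omega))
    have : r 1 = x := by simpa [hx] using hr1
    simp only [hx, Finset.mem_singleton]
    constructor
    · rintro rfl
      exact ⟨1, le_rfl, le_rfl, this⟩
    · rintro ⟨j, h1, h2, rfl⟩
      rw [← this, le_antisymm h2 h1]
  | succ k hk ih =>
    intro hn c
    have hp := hprev (k + 1) (by omega) hn
    have hr := hmem (k + 1) (by omega) hn
    rw [Nat.add_sub_cancel] at hp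
    rw [← Finset.insert_erase hr, ← hp, Finset.mem_insert, ih (by omega)]
    constructor
    · rintro (rfl | ⟨j, h1, h2, h3⟩)
      · exact ⟨k + 1, by omega, le_rfl, rfl⟩
      · exact ⟨j, h1, by omega, h3⟩
    · rintro ⟨j, h1, h2, h3⟩
      obtain rfl | h2 := h2.eq_or_lt
      · exact Or.inl h3.symm
      · exact Or.inr ⟨j, h1, by omega, h3⟩

/-- Let `M` be a mosaic floorplan in standard form with `n ≥ 2`
blocks, and let `R n = M, R (n-1), …, R 1` be obtained by successively removing a
deletable rectangle `r i` from `R i`; let `r 1` be the unique block of `R 1`.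
Then for every `i` with `2 ≤ i ≤ n`, the block `r (i-1)` is adjacent to `r i`. -/
theorem consecutive_deletable_adjacent (n : ℕ) (hn : 2 ≤ n)
    (M : Finset (Set (ℝ × ℝ))) (hM : IsMosaicFloorplan M) (hstd : StandardForm M)
    (hcard : M.card = n)
    (R : ℕ → Finset (Set (ℝ × ℝ))) (r : ℕ → Set (ℝ × ℝ))
    (hRn : R n = M)
    (hdel : ∀ i, 2 ≤ i → i ≤ n → IsDeletable (R i) (r i))
    (hprev : ∀ i, 2 ≤ i → i ≤ n → R (i - 1) = (R i).erase (r i))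
    (hr1 : r 1 ∈ R 1) :
    ∀ i, 2 ≤ i → i ≤ n → Adjacent (r (i - 1)) (r i) := by
  subst hRn
  obtain ⟨F, hF⟩ := hM.exists_dissection
  have hS := hF.std hstd
  have hS' := hF.std_transpose hstd
  have hmem := mem_iff_of_erase hcard (fun i h1 h2 => (hdel i h1 h2).1) hprev hr1
  have hrM : ∀ k, 1 ≤ k → k ≤ n → r k ∈ R n := fun k h1 h2 =>
    (hmem n (by omega) le_rfl _).2 ⟨k, h1, h2, rfl⟩
  have hne : ∀ k k', 1 ≤ k → k < k' → k' ≤ n → r k ≠ r k' := fun k k' h1 h2 h3 => by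
    have h4 := (hmem (k' - 1) (by omega) (by omega) _).2 ⟨k, h1, by omega, rfl⟩
    rw [hprev k' (by omega) h3] at h4
    exact Finset.ne_of_mem_erase h4
  have hsucc : ∀ k, 1 ≤ k → k ≤ n → ∀ i j : R n, (i : Set (ℝ × ℝ)) = r k →
      (F.Below i j ∨ F.transpose.Below i j) → ∃ m, k < m ∧ m ≤ n ∧ (j : Set (ℝ × ℝ)) = r m := by
    intro k h1 h2 i j hi hB
    obtain ⟨m, hm1, hm2, hm⟩ := (hmem n (by omega) le_rfl _).1 j.2
    refine ⟨m, ?_, hm2, hm.symm⟩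
    by_contra! hmk
    have hiR : (i : Set (ℝ × ℝ)) ∈ R k := (hmem k h1 h2 _).2 ⟨k, h1, le_rfl, hi.symm⟩
    have hjR : (j : Set (ℝ × ℝ)) ∈ R k := (hmem k h1 h2 _).2 ⟨m, hm1, hmk, hm⟩
    obtain rfl | hk := h1.eq_or_lt
    · obtain rfl : m = 1 := by omega
      obtain rfl : i = j := Subtype.ext (hi.trans hm)
      rcases hB with hB | hB
      · exact (F.bt i).ne' hB.1
      · exact (F.lr i).ne' hB.1
    · have hd := hi ▸ hdel k hk h2
      rcases hB with hB | hB
      · exact hF.not_isDeletable_of_above hiR hjR hB.1 (hB.left_lt_right hS) hB.2.1.1 hd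
      · exact hF.not_isDeletable_of_right hiR hjR hB.1 (hB.left_lt_right hS') hB.2.1.1 hd
  have hcorner : F.r ⟨r n, hrM n (by omega) le_rfl⟩ = F.x₁ ∧
      F.t ⟨r n, hrM n (by omega) le_rfl⟩ = F.y₁ := by
    by_contra hc
    obtain ⟨j, hj⟩ := F.exists_below_or_left _ hc
    obtain ⟨m, h1, h2, -⟩ := hsucc n (by omega) le_rfl _ j rfl hj
    omega
  have key := rel_succ_of_leftUnique (n := n) (P := fun k m => ∃ i j : R n,
    (i : Set (ℝ × ℝ)) = r k ∧ (j : Set (ℝ × ℝ)) = r m ∧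
      (F.Below i j ∨ F.transpose.Below i j)) ?_ ?_
  · intro k h1 h2
    obtain ⟨i, j, hi, hj, hB⟩ := key (k - 1) (by omega) (by omega)
    rw [Nat.sub_add_cancel (by omega)] at hj
    rw [← hi, ← hj]
    rcases hB with hB | hB
    · exact hF.adjacent_of_above hB.1 (hB.left_lt_right hS) hB.2.1.1
    · exact hF.adjacent_of_right hB.1 (hB.left_lt_right hS') hB.2.1.1
  · intro k h1 h2
    obtain ⟨j, hj⟩ := F.exists_below_or_left ⟨r k, hrM k h1 h2.le⟩ fun hc => by
      have := F.eq_of_overlap (i := ⟨r k, hrM k h1 h2.le⟩) (j := ⟨r n, hrM n (by omega) le_rfl⟩)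
        (by rw [hcorner.1, ← hc.1]; exact F.lr _) (by rw [hc.1, ← hcorner.1]; exact F.lr _)
        (by rw [hcorner.2, ← hc.2]; exact F.bt _) (by rw [hc.2, ← hcorner.2]; exact F.bt _)
      exact hne k n h1 h2 le_rfl (congrArg Subtype.val this)
    obtain ⟨m, h3, h4, h5⟩ := hsucc k h1 h2.le _ j rfl hj
    exact ⟨m, h3, h4, _, j, rfl, h5, hj⟩
  · rintro k k' m h1 h2 h3 ⟨i, j, hi, hj, hB⟩ ⟨i', j', hi', hj', hB'⟩
    obtain rfl : j = j' := Subtype.ext (hj.trans hj'.symm)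
    refine hne k k' h1 h2 h3.le ?_
    rw [← hi, ← hi']
    rcases hB with hB | hB <;> rcases hB' with hB' | hB'
    · rw [hB.left_unique hB']
    · exact (hB.not_transpose hB').elim
    · exact (hB'.not_transpose hB).elim
    · rw [hB.left_unique hB']
end
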